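/- The expected weighted squared distance to the instance satisfies E[π(X) · ‖X−ξ‖²] = C_d · ( (ν⁴/(ν²+σ²)²) · ‖ξ−μ‖² + ν²σ²d/(ν²+σ²) ). -/

import Mathlib

open Real MeasureTheory ProbabilityTheory

/-- Completing the square: a Gaussian weight times a Gaussian density is a multiple of a Gaussian
density. -/
lemma gaussianPDFReal_mul_exp (ξ μ : ℝ) {v w : NNReal} (hv : v ≠ 0) (hw : w ≠ 0) (x : ℝ) :
    gaussianPDFReal μ v x * exp (-(x - ξ) ^ 2 / (2 * w))
      = √(w / (w + v)) * exp (-(ξ - μ) ^ 2 / (2 * (w + v))) *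
        gaussianPDFReal ((w * μ + v * ξ) / (w + v)) (w * v / (w + v)) x := by
  have hv' : 0 < (v : ℝ) := NNReal.coe_pos.mpr (pos_iff_ne_zero.mpr hv)
  have hw' : 0 < (w : ℝ) := NNReal.coe_pos.mpr (pos_iff_ne_zero.mpr hw)
  have hsqrt : (√(2 * π * v))⁻¹ = √(w / (w + v)) * (√(2 * π * (w * v / (w + v))))⁻¹ := by
    rw [← sqrt_inv, ← sqrt_inv, ← sqrt_mul (by positivity)]
    congr 1
    field_simp
  have hexp : -(x - μ) ^ 2 / (2 * v) + -(x - ξ) ^ 2 / (2 * w) =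
      -(ξ - μ) ^ 2 / (2 * (w + v)) +
        -(x - (w * μ + v * ξ) / (w + v)) ^ 2 / (2 * (w * v / (w + v))) := by
    field_simp
    ring
  simp only [gaussianPDFReal, NNReal.coe_div, NNReal.coe_mul, NNReal.coe_add]
  rw [mul_assoc, ← exp_add, hexp, exp_add, hsqrt]
  ring

lemma integral_exp_mul_gaussianReal (ξ μ : ℝ) {v w : NNReal} (hv : v ≠ 0) (hw : w ≠ 0)
    (f : ℝ → ℝ) :
    ∫ x, exp (-(x - ξ) ^ 2 / (2 * w)) * f x ∂gaussianReal μ v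
      = √(w / (w + v)) * exp (-(ξ - μ) ^ 2 / (2 * (w + v))) *
        ∫ x, f x ∂gaussianReal ((w * μ + v * ξ) / (w + v)) (w * v / (w + v)) := by
  rw [integral_gaussianReal_eq_integral_smul hv,
    integral_gaussianReal_eq_integral_smul (by positivity), ← integral_const_mul]
  refine integral_congr_ae (.of_forall fun x => ?_)
  simp only [smul_eq_mul]
  rw [← mul_assoc, gaussianPDFReal_mul_exp ξ μ hv hw, mul_assoc]

lemma integrable_sub_sq_gaussianReal (μ ξ : ℝ) (v : NNReal) :
    Integrable (fun x => (x - ξ) ^ 2) (gaussianReal μ v) :=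
  ((memLp_id_gaussianReal 2).sub (memLp_const ξ)).integrable_sq

/-- The second moment of a real Gaussian about an arbitrary point. -/
lemma integral_sub_sq_gaussianReal (μ ξ : ℝ) (v : NNReal) :
    ∫ x, (x - ξ) ^ 2 ∂gaussianReal μ v = (μ - ξ) ^ 2 + v := by
  have hvar := variance_eq_sub (μ := gaussianReal (μ - ξ) v) (X := id) (memLp_id_gaussianReal 2)
  have hmap := integral_map (μ := gaussianReal μ v) (φ := fun x => x - ξ) (by fun_prop)
    (f := fun x : ℝ => x ^ 2) (by fun_prop)
  rw [gaussianReal_map_sub_const] at hmap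
  rw [variance_id_gaussianReal] at hvar
  simp only [Pi.pow_apply, id_eq, integral_id_gaussianReal] at hvar
  rw [← hmap]
  linarith

/-- Expected weighted squared distance to the instance:
`E[π(X) ‖X−ξ‖²] = C_d (ν⁴/(ν²+σ²)² ‖ξ−μ‖² + ν²σ²d/(ν²+σ²))`. -/
theorem expected_weight_sq_distance (d : ℕ) (hd : 1 ≤ d) (ξ μ : Fin d → ℝ) (σ ν : ℝ)
    (hσ : 0 < σ) (hν : 0 < ν)
    (Cd : ℝ)
    (hCd : Cd = (ν ^ 2 / (ν ^ 2 + σ ^ 2)) ^ ((d : ℝ) / 2) *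
        Real.exp (-(∑ j, (ξ j - μ j) ^ 2) / (2 * (ν ^ 2 + σ ^ 2))))
    (P : Measure (Fin d → ℝ))
    (hP : P = Measure.pi fun j => gaussianReal (μ j) ⟨σ ^ 2, sq_nonneg σ⟩) :
    ∫ x, Real.exp (-(∑ j, (x j - ξ j) ^ 2) / (2 * ν ^ 2)) * (∑ j, (x j - ξ j) ^ 2) ∂P
      = Cd * (ν ^ 4 / (ν ^ 2 + σ ^ 2) ^ 2 * (∑ j, (ξ j - μ j) ^ 2)
          + ν ^ 2 * σ ^ 2 * d / (ν ^ 2 + σ ^ 2)) := by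
  obtain ⟨v, hv, hP⟩ : ∃ v : NNReal, (v : ℝ) = σ ^ 2 ∧
      P = Measure.pi fun j => gaussianReal (μ j) v := ⟨_, rfl, hP⟩
  obtain ⟨w, hw⟩ : ∃ w : NNReal, (w : ℝ) = ν ^ 2 := ⟨⟨ν ^ 2, sq_nonneg ν⟩, rfl⟩
  have hv0 : v ≠ 0 := by
    rw [← NNReal.coe_ne_zero, hv]
    positivity
  have hw0 : w ≠ 0 := by
    rw [← NNReal.coe_ne_zero, hw]
    positivity
  have hexp (a : Fin d → ℝ) (b : ℝ) :
      exp (-(∑ j, a j ^ 2) / b) = ∏ j, exp (-a j ^ 2 / b) := by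
    rw [← exp_sum, ← Finset.sum_div, Finset.sum_neg_distrib]
  have hC : Cd = ∏ j, (√(ν ^ 2 / (ν ^ 2 + σ ^ 2)) *
      exp (-(ξ j - μ j) ^ 2 / (2 * (ν ^ 2 + σ ^ 2)))) := by
    rw [hCd, Finset.prod_mul_distrib, hexp, Finset.prod_const, Finset.card_univ, Fintype.card_fin,
      sqrt_eq_rpow, ← rpow_mul_natCast (by positivity)]
    congr 2
    ring
  let F (j i : Fin d) (x : ℝ) : ℝ :=
    exp (-(x - ξ i) ^ 2 / (2 * ν ^ 2)) * if i = j then (x - ξ i) ^ 2 else 1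
  have hF (x : Fin d → ℝ) :
      exp (-(∑ j, (x j - ξ j) ^ 2) / (2 * ν ^ 2)) * (∑ j, (x j - ξ j) ^ 2)
        = ∑ j, ∏ i, F j i (x i) := by
    simp only [F, Finset.prod_mul_distrib, Finset.prod_ite_eq', Finset.mem_univ, if_true,
      ← Finset.mul_sum, hexp]
  have hint (j : Fin d) : Integrable (fun x : Fin d → ℝ => ∏ i, F j i (x i)) P := by
    rw [hP]
    refine Integrable.fintype_prod_dep fun i => ?_
    refine Integrable.bdd_mul (c := 1) ?_ (by fun_prop) (.of_forall fun x => ?_)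
    · split_ifs
      · exact integrable_sub_sq_gaussianReal _ _ _
      · exact integrable_const _
    · rw [norm_of_nonneg (exp_nonneg _), exp_le_one_iff, neg_div]
      exact neg_nonpos.mpr (by positivity)
  have hval (j : Fin d) : ∫ x, ∏ i, F j i (x i) ∂P
      = Cd * (ν ^ 4 / (ν ^ 2 + σ ^ 2) ^ 2 * (ξ j - μ j) ^ 2
          + ν ^ 2 * σ ^ 2 / (ν ^ 2 + σ ^ 2)) := by
    have hone (i : Fin d) : ∫ x, F j i x ∂gaussianReal (μ i) v
        = √(ν ^ 2 / (ν ^ 2 + σ ^ 2)) * exp (-(ξ i - μ i) ^ 2 / (2 * (ν ^ 2 + σ ^ 2))) *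
          if i = j then ν ^ 4 / (ν ^ 2 + σ ^ 2) ^ 2 * (ξ i - μ i) ^ 2
            + ν ^ 2 * σ ^ 2 / (ν ^ 2 + σ ^ 2) else 1 := by
      simp only [F]
      rw [← hw, ← hv, integral_exp_mul_gaussianReal _ _ hv0 hw0]
      congr 1
      split_ifs
      · rw [integral_sub_sq_gaussianReal, NNReal.coe_div, NNReal.coe_mul,
          NNReal.coe_add, hv, hw]
        field_simp
        ring
      · simp
    rw [hP, integral_fintype_prod_eq_prod, Finset.prod_congr rfl fun i _ => hone i,
      Finset.prod_mul_distrib, ← hC, Finset.prod_ite_eq', if_pos (Finset.mem_univ j)]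
  simp_rw [hF]
  rw [integral_finsetSum _ fun j _ => hint j, Finset.sum_congr rfl fun j _ => hval j,
    ← Finset.mul_sum, Finset.sum_add_distrib, ← Finset.mul_sum, Finset.sum_const,
    Finset.card_univ, Fintype.card_fin, nsmul_eq_mul]
  ring
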